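/- For every integer n ≥ 3, the toroidal grid graph T_{n+1,n} admits a bramble of order 2n, namely the family B = F ∪ G where an element of F is a column missing one vertex together with a full row, and an element of G is a column missing one vertex together with two rows each missing one vertex (intersection vertices of a used row and column are never deleted); in particular bn(T_{n+1,n}) ≥ 2n. -/

import Mathlib

open SimpleGraph

/-- A tree decomposition of a graph `G`: a tree `tree` on node type `ι` with a bag of
vertices of `G` at each node, such that every vertex lies in some bag, both endpoints of
every edge lie in a common bag, and for each vertex the set of nodes whose bags contain it
induces a connected subgraph of the tree. -/
structure TreeDecomp {V : Type*} (G : SimpleGraph V) where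
  ι : Type
  tree : SimpleGraph ι
  isTree : tree.IsTree
  bag : ι → Set V
  bag_cover : ∀ v : V, ∃ t, v ∈ bag t
  bag_edge : ∀ ⦃u v : V⦄, G.Adj u v → ∃ t, u ∈ bag t ∧ v ∈ bag t
  bag_conn : ∀ v : V, (tree.induce {t | v ∈ bag t}).Connected

/-- The treewidth of `G`: the least `k` such that some tree decomposition of `G` has all
bags of size at most `k + 1` (i.e. the minimum over tree decompositions of one less than
the maximum bag size). -/
noncomputable def treewidth {V : Type*} (G : SimpleGraph V) : ℕ :=
  sInf {k : ℕ | ∃ D : TreeDecomp G, ∀ t, (D.bag t).ncard ≤ k + 1}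

/-- Two vertex sets touch if their union induces a connected subgraph. -/
def Touches {V : Type*} (G : SimpleGraph V) (A B : Set V) : Prop :=
  (G.induce (A ∪ B)).Connected

/-- A bramble: a family of vertex sets, each inducing a connected subgraph,
that pairwise touch. -/
structure IsBramble {V : Type*} (G : SimpleGraph V) (ℬ : Set (Set V)) : Prop where
  conn : ∀ B ∈ ℬ, (G.induce B).Connected
  touch : ∀ A ∈ ℬ, ∀ B ∈ ℬ, Touches G A B

/-- A strict bramble: a bramble any two of whose members share a vertex. -/
def IsStrictBramble {V : Type*} (G : SimpleGraph V) (ℬ : Set (Set V)) : Prop :=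
  IsBramble G ℬ ∧ ∀ A ∈ ℬ, ∀ B ∈ ℬ, (A ∩ B).Nonempty

/-- A hitting set for a family of vertex sets: a set meeting every member. -/
def IsHittingSet {V : Type*} (ℬ : Set (Set V)) (S : Set V) : Prop :=
  ∀ B ∈ ℬ, (S ∩ B).Nonempty

/-- The order of a bramble: the minimum size of a hitting set. -/
noncomputable def brambleOrder {V : Type*} (ℬ : Set (Set V)) : ℕ :=
  sInf {k : ℕ | ∃ S : Set V, IsHittingSet ℬ S ∧ S.ncard = k}

/-- The bramble number of `G`: the maximum order of a bramble on `G`. -/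
noncomputable def brambleNumber {V : Type*} (G : SimpleGraph V) : ℕ :=
  sSup {k : ℕ | ∃ ℬ, IsBramble G ℬ ∧ brambleOrder ℬ = k}

/-- The strict bramble number of `G`: the maximum order of a strict bramble on `G`. -/
noncomputable def strictBrambleNumber {V : Type*} (G : SimpleGraph V) : ℕ :=
  sSup {k : ℕ | ∃ ℬ, IsStrictBramble G ℬ ∧ brambleOrder ℬ = k}

/-- The `m × n` grid graph `P_m □ P_n`. -/
def gridGraph (m n : ℕ) : SimpleGraph (Fin m × Fin n) :=
  SimpleGraph.pathGraph m □ SimpleGraph.pathGraph n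

/-- The stacked prism graph `Y_{m,n} = C_m □ P_n`. -/
def stackedPrism (m n : ℕ) : SimpleGraph (Fin m × Fin n) :=
  SimpleGraph.cycleGraph m □ SimpleGraph.pathGraph n

/-- The toroidal grid graph `T_{m,n} = C_m □ C_n`. -/
def toroidalGrid (m n : ℕ) : SimpleGraph (Fin m × Fin n) :=
  SimpleGraph.cycleGraph m □ SimpleGraph.cycleGraph n

/-- `H` is a minor of `G`: there are pairwise disjoint nonempty connected branch sets in `G`,
one for each vertex of `H`, with an edge of `G` between the branch sets of any two vertices
adjacent in `H`. -/
def IsGraphMinor {W V : Type*} (H : SimpleGraph W) (G : SimpleGraph V) : Prop :=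
  ∃ B : W → Set V,
    (∀ w, (B w).Nonempty) ∧
    (∀ w, (G.induce (B w)).Connected) ∧
    (∀ w₁ w₂, w₁ ≠ w₂ → Disjoint (B w₁) (B w₂)) ∧
    (∀ ⦃w₁ w₂⦄, H.Adj w₁ w₂ → ∃ v₁ ∈ B w₁, ∃ v₂ ∈ B w₂, G.Adj v₁ v₂)

open Classical in
/-- The chip-firing move at a vertex `v`: `v` loses one chip along each incident edge,
each neighbor of `v` gains one chip. -/
noncomputable def fireVertex {V : Type*} (G : SimpleGraph V) (D : V → ℤ) (v : V) : V → ℤ :=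
  fun u => if u = v then D u - (G.neighborSet v).ncard
    else if G.Adj v u then D u + 1 else D u

/-- Two divisors on `G` are equivalent if one is obtained from the other by a finite
sequence of chip-firing moves. -/
def ChipEquiv {V : Type*} (G : SimpleGraph V) : (V → ℤ) → (V → ℤ) → Prop :=
  Relation.EqvGen (fun D D' => ∃ v, D' = fireVertex G D v)

/-- A divisor `D` wins the gonality game on `G` if for every vertex `q`, the divisor
`D - q` is equivalent to an effective divisor. -/
def WinsGonalityGame {V : Type*} [DecidableEq V] (G : SimpleGraph V) (D : V → ℤ) : Prop :=
  ∀ q : V, ∃ E : V → ℤ, (∀ v, 0 ≤ E v) ∧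
    ChipEquiv G (fun v => D v - if v = q then 1 else 0) E

/-- The divisorial gonality of `G`: the least degree of an effective divisor winning the
gonality game. -/
noncomputable def gonality {V : Type*} [Fintype V] [DecidableEq V] (G : SimpleGraph V) : ℕ :=
  sInf {k : ℕ | ∃ D : V → ℤ, (∀ v, 0 ≤ D v) ∧ (∑ v, D v) = (k : ℤ) ∧ WinsGonalityGame G D}

/-- Two connected vertex sets joined by an edge or sharing a vertex have connected union. -/
theorem induce_union_connected_of_eq_or_adj {V : Type*} {G : SimpleGraph V} {s t : Set V}
    (hs : (G.induce s).Connected) (ht : (G.induce t).Connected) {a b : V} (ha : a ∈ s)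
    (hb : b ∈ t) (hab : a = b ∨ G.Adj a b) : (G.induce (s ∪ t)).Connected := by
  rcases hab with rfl | hab
  · exact induce_union_connected hs.preconnected ht.preconnected ⟨a, ha, hb⟩
  · have h₁ : (G.induce (s ∪ {a, b})).Connected :=
      induce_union_connected hs.preconnected
        (induce_pair_connected_of_adj hab).preconnected ⟨a, ha, by simp⟩
    have h₂ : (G.induce (s ∪ {a, b} ∪ t)).Connected :=
      induce_union_connected h₁.preconnected ht.preconnected ⟨b, by simp, hb⟩
    have h : s ∪ {a, b} ∪ t = s ∪ t := by
      ext x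
      simp only [Set.mem_union, Set.mem_insert_iff, Set.mem_singleton_iff]
      grind
    rwa [h] at h₂

theorem cycleGraph_adj_add_one {n : ℕ} (x : Fin (n + 2)) :
    (cycleGraph (n + 2)).Adj x (x + 1) :=
  cycleGraph_adj.2 (Or.inr (by simp))

theorem exists_cycleGraph_adj {m : ℕ} (hm : 2 ≤ m) (x : Fin m) :
    ∃ y, (cycleGraph m).Adj x y := by
  obtain ⟨k, rfl⟩ := Nat.exists_eq_add_of_le' hm
  exact ⟨x + 1, cycleGraph_adj_add_one x⟩

open Fin.CommRing in
/-- A cycle with one vertex removed is connected. -/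
theorem cycleGraph_induce_compl_singleton_connected {m : ℕ} (hm : 2 ≤ m) (d : Fin m) :
    ((cycleGraph m).induce {d}ᶜ).Connected := by
  obtain ⟨n, rfl⟩ := Nat.exists_eq_add_of_le' hm
  have hne : ∀ k : ℕ, k < n + 1 → d + 1 + (k : Fin (n + 2)) ∈ ({d}ᶜ : Set (Fin (n + 2))) := by
    intro k hk h
    have h' : ((k + 1 : ℕ) : Fin (n + 2)) = 0 := by
      have h₀ : d + 1 + (k : Fin (n + 2)) = d := h
      push_cast
      rw [add_assoc, add_eq_left] at h₀
      rwa [add_comm (1 : Fin (n + 2))] at h₀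
    rw [Fin.natCast_eq_zero] at h'
    exact absurd (Nat.le_of_dvd (by omega) h') (by omega)
  have hreach : ∀ (k : ℕ) (hk : k < n + 1),
      ((cycleGraph (n + 2)).induce {d}ᶜ).Reachable ⟨_, hne 0 (by omega)⟩ ⟨_, hne k hk⟩ := by
    intro k
    induction k with
    | zero => exact fun _ => Reachable.rfl
    | succ k ih =>
      intro hk
      refine (ih (by omega)).trans (Adj.reachable ?_)
      have h := cycleGraph_adj_add_one (d + 1 + (k : Fin (n + 2)))
      rw [induce_adj]
      simpa [add_assoc] using h
  have hcover : ∀ x : ({d}ᶜ : Set (Fin (n + 2))),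
      ∃ (k : ℕ) (hk : k < n + 1), x = ⟨_, hne k hk⟩ := by
    rintro ⟨x, hx⟩
    have hval : (x - d).val ≠ 0 := by
      intro h
      exact hx (sub_eq_zero.1 (Fin.ext h))
    have hlt := (x - d).isLt
    refine ⟨(x - d).val - 1, by omega, Subtype.ext ?_⟩
    have h : (((x - d).val - 1 + 1 : ℕ) : Fin (n + 2)) = x - d := by
      rw [Nat.sub_add_cancel (by omega)]
      simp
    push_cast at h
    change x = d + 1 + _
    rw [add_assoc, add_comm 1, h, add_sub_cancel]
  have : Nonempty ({d}ᶜ : Set (Fin (n + 2))) := ⟨⟨_, hne 0 (by omega)⟩⟩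
  refine ⟨fun x y => ?_⟩
  obtain ⟨i, hi, rfl⟩ := hcover x
  obtain ⟨j, hj, rfl⟩ := hcover y
  exact (hreach i hi).symm.trans (hreach j hj)

/-- The image of a connected vertex set under a graph homomorphism is connected. -/
theorem induce_image_connected {V W : Type*} {G : SimpleGraph V} {H : SimpleGraph W}
    (f : G →g H) {s : Set V} (hs : (G.induce s).Connected) :
    (H.induce (f '' s)).Connected :=
  hs.map (induceHom f (Set.mapsTo_image f s)) (by
    rintro ⟨_, x, hx, rfl⟩
    exact ⟨⟨x, hx⟩, rfl⟩)

section ToroidalGrid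

variable {m n : ℕ}

/-- A column of the toroidal grid with one vertex removed is connected. -/
theorem toroidalGrid_column_diff_connected (hm : 2 ≤ m) (c : Fin n) (d : Fin m) :
    ((toroidalGrid m n).induce ({v | v.2 = c} \ {(d, c)})).Connected := by
  have h : ({v : Fin m × Fin n | v.2 = c} \ {(d, c)}) =
      (boxProdLeft (cycleGraph m) (cycleGraph n) c).toHom '' {d}ᶜ := by
    ext ⟨x, y⟩
    simp
    grind
  rw [h]
  exact induce_image_connected (boxProdLeft (cycleGraph m) (cycleGraph n) c).toHom
    (cycleGraph_induce_compl_singleton_connected hm d)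

/-- A row of the toroidal grid with one vertex removed is connected. -/
theorem toroidalGrid_row_diff_connected (hn : 2 ≤ n) (r : Fin m) (e : Fin n) :
    ((toroidalGrid m n).induce ({v | v.1 = r} \ {(r, e)})).Connected := by
  have h : ({v : Fin m × Fin n | v.1 = r} \ {(r, e)}) =
      (boxProdRight (cycleGraph m) (cycleGraph n) r).toHom '' {e}ᶜ := by
    ext ⟨x, y⟩
    simp
    grind
  rw [h]
  exact induce_image_connected (boxProdRight (cycleGraph m) (cycleGraph n) r).toHom
    (cycleGraph_induce_compl_singleton_connected hn e)

/-- A row of the toroidal grid is connected. -/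
theorem toroidalGrid_row_connected (hn : 1 ≤ n) (r : Fin m) :
    ((toroidalGrid m n).induce {v | v.1 = r}).Connected := by
  obtain ⟨k, rfl⟩ := Nat.exists_eq_add_of_le' hn
  have h : {v : Fin m × Fin (k + 1) | v.1 = r} =
      (boxProdRight (cycleGraph m) (cycleGraph (k + 1)) r).toHom '' Set.univ := by
    ext ⟨x, y⟩
    simp
    grind
  rw [h]
  exact induce_image_connected (boxProdRight (cycleGraph m) (cycleGraph (k + 1)) r).toHom
    (s := Set.univ) ((induceUnivIso _).connected_iff.2 cycleGraph_connected)

/-- A full row meets, or is joined by an edge to, every column missing one vertex. -/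
theorem toroidalGrid_row_column_eq_or_adj (hm : 2 ≤ m) (r d : Fin m) (c : Fin n) :
    ∃ a ∈ {v : Fin m × Fin n | v.1 = r},
      ∃ b ∈ ({v : Fin m × Fin n | v.2 = c} \ {(d, c)}), a = b ∨ (toroidalGrid m n).Adj a b := by
  by_cases h : r = d
  · obtain ⟨y, hy⟩ := exists_cycleGraph_adj hm r
    have hne := hy.ne
    exact ⟨(r, c), rfl, (y, c), by simp; grind, Or.inr (boxProd_adj_left.2 hy)⟩
  · exact ⟨(r, c), rfl, (r, c), by simp [h], Or.inl rfl⟩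

/-- A row missing one vertex meets, or is joined by an edge to, every column missing one vertex
outside that row. -/
theorem toroidalGrid_row_diff_column_eq_or_adj (hn : 2 ≤ n) {r d : Fin m} (h : r ≠ d)
    (e c : Fin n) :
    ∃ a ∈ ({v : Fin m × Fin n | v.1 = r} \ {(r, e)}),
      ∃ b ∈ ({v : Fin m × Fin n | v.2 = c} \ {(d, c)}), a = b ∨ (toroidalGrid m n).Adj a b := by
  by_cases hc : c = e
  · obtain ⟨y, hy⟩ := exists_cycleGraph_adj hn c
    have hne := hy.ne
    exact ⟨(r, y), by simp; grind, (r, c), by simp [h], Or.inr (boxProd_adj_right.2 hy.symm)⟩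
  · exact ⟨(r, c), by simp [hc], (r, c), by simp [h], Or.inl rfl⟩

end ToroidalGrid

/-- A set of fewer than `2 * n` vertices in an `(n + 1) × n` array that meets every row meets at
least three rows in exactly one vertex. -/
theorem two_lt_card_rows_of_card_lt {n : ℕ} {S : Finset (Fin (n + 1) × Fin n)}
    (hS : S.card < 2 * n) (hrow : ∀ r, ∃ e, (r, e) ∈ S) :
    2 < (Finset.univ.filter fun r => (S.filter fun v => v.1 = r).card = 1).card := by
  have hsum : S.card = ∑ r, (S.filter fun v => v.1 = r).card :=
    Finset.card_eq_sum_card_fiberwise fun _ _ => by simp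
  have hle : ∑ _r : Fin (n + 1), 2 ≤ ∑ r : Fin (n + 1), ((S.filter fun v => v.1 = r).card +
      if (S.filter fun v => v.1 = r).card = 1 then 1 else 0) := by
    refine Finset.sum_le_sum fun r _ => ?_
    obtain ⟨e, he⟩ := hrow r
    have hpos : 0 < (S.filter fun v => v.1 = r).card :=
      Finset.card_pos.2 ⟨(r, e), by simp [he]⟩
    split_ifs <;> omega
  rw [Finset.sum_add_distrib, ← hsum, ← Finset.card_filter] at hle
  simp only [Finset.sum_const, Finset.card_univ, Fintype.card_fin, smul_eq_mul] at hle
  omega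

theorem exists_unique_col_of_card_row_eq_one {m n : ℕ} {S : Finset (Fin m × Fin n)} {r : Fin m}
    (h : (S.filter fun v => v.1 = r).card = 1) : ∃ e, ∀ y, (r, y) ∈ S ↔ y = e := by
  obtain ⟨⟨x, e⟩, hp⟩ := Finset.card_eq_one.1 h
  have hmem : ∀ v, v ∈ S ∧ v.1 = r ↔ v = (x, e) := fun v => by
    simpa using Finset.ext_iff.1 hp v
  obtain rfl : x = r := ((hmem (x, e)).2 rfl).2
  exact ⟨e, fun y => by simpa using hmem (x, y)⟩

/-- The order of a bramble on a finite graph is at most the number of vertices. -/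
theorem brambleOrder_le_card {V : Type*} [Finite V] {G : SimpleGraph V} {ℬ : Set (Set V)}
    (h : IsBramble G ℬ) : brambleOrder ℬ ≤ Nat.card V := by
  refine Nat.sInf_le ⟨Set.univ, fun B hB => ?_, Set.ncard_univ V⟩
  rw [Set.univ_inter]
  exact Set.nonempty_coe_sort.1 (h.conn B hB).nonempty

theorem brambleOrder_le_brambleNumber {V : Type*} [Finite V] {G : SimpleGraph V}
    {ℬ : Set (Set V)} (h : IsBramble G ℬ) : brambleOrder ℬ ≤ brambleNumber G :=
  le_csSup ⟨Nat.card V, by rintro _ ⟨ℬ', h', rfl⟩; exact brambleOrder_le_card h'⟩ ⟨ℬ, h, rfl⟩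

/-- The order of a family is `k` if it has a hitting set of size `k` and none smaller. -/
theorem brambleOrder_eq {V : Type*} {ℬ : Set (Set V)} {k : ℕ} {S : Set V}
    (hS : IsHittingSet ℬ S) (hcard : S.ncard = k)
    (hmin : ∀ T, IsHittingSet ℬ T → k ≤ T.ncard) : brambleOrder ℬ = k :=
  le_antisymm (Nat.sInf_le ⟨S, hS, hcard⟩)
    (le_csInf ⟨k, S, hS, hcard⟩ (by rintro _ ⟨T, hT, rfl⟩; exact hmin T hT))

/-- For `n ≥ 3`, the family `B = F ∪ G` on `T_{n+1,n}` — where an element of `F` is a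
column missing one vertex together with a full row, and an element of `G` is a column
missing one vertex together with two rows each missing one vertex (intersection vertices
of a used row and column are never deleted) — is a bramble of order `2n`;
in particular `bn(T_{n+1,n}) ≥ 2n`. -/
theorem toroidalGrid_bramble_almost_square (n : ℕ) (hn : 3 ≤ n) :
    IsBramble (toroidalGrid (n + 1) n)
        ({B | ∃ (c : Fin n) (d r : Fin (n + 1)), d ≠ r ∧
            B = ({v : Fin (n + 1) × Fin n | v.2 = c} \ {(d, c)}) ∪
              {v : Fin (n + 1) × Fin n | v.1 = r}} ∪
          {B | ∃ (c : Fin n) (d r₁ r₂ : Fin (n + 1)) (e₁ e₂ : Fin n),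
            r₁ ≠ r₂ ∧ d ≠ r₁ ∧ d ≠ r₂ ∧ e₁ ≠ c ∧ e₂ ≠ c ∧
            B = ({v : Fin (n + 1) × Fin n | v.2 = c} \ {(d, c)}) ∪
              ({v : Fin (n + 1) × Fin n | v.1 = r₁} \ {(r₁, e₁)}) ∪
              ({v : Fin (n + 1) × Fin n | v.1 = r₂} \ {(r₂, e₂)})}) ∧
      brambleOrder
        ({B | ∃ (c : Fin n) (d r : Fin (n + 1)), d ≠ r ∧
            B = ({v : Fin (n + 1) × Fin n | v.2 = c} \ {(d, c)}) ∪
              {v : Fin (n + 1) × Fin n | v.1 = r}} ∪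
          {B | ∃ (c : Fin n) (d r₁ r₂ : Fin (n + 1)) (e₁ e₂ : Fin n),
            r₁ ≠ r₂ ∧ d ≠ r₁ ∧ d ≠ r₂ ∧ e₁ ≠ c ∧ e₂ ≠ c ∧
            B = ({v : Fin (n + 1) × Fin n | v.2 = c} \ {(d, c)}) ∪
              ({v : Fin (n + 1) × Fin n | v.1 = r₁} \ {(r₁, e₁)}) ∪
              ({v : Fin (n + 1) × Fin n | v.1 = r₂} \ {(r₂, e₂)})}) = 2 * n ∧
      2 * n ≤ brambleNumber (toroidalGrid (n + 1) n) := by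
  set ℬ : Set (Set (Fin (n + 1) × Fin n)) := _ ∪ _
  have hF : ∀ (c : Fin n) (d r : Fin (n + 1)), d ≠ r →
      ({v : Fin (n + 1) × Fin n | v.2 = c} \ {(d, c)}) ∪
        {v : Fin (n + 1) × Fin n | v.1 = r} ∈ ℬ :=
    fun c d r h => Or.inl ⟨c, d, r, h, rfl⟩
  have hG : ∀ (c : Fin n) (d r₁ r₂ : Fin (n + 1)) (e₁ e₂ : Fin n),
      r₁ ≠ r₂ → d ≠ r₁ → d ≠ r₂ → e₁ ≠ c → e₂ ≠ c →
      ({v : Fin (n + 1) × Fin n | v.2 = c} \ {(d, c)}) ∪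
        ({v : Fin (n + 1) × Fin n | v.1 = r₁} \ {(r₁, e₁)}) ∪
        ({v : Fin (n + 1) × Fin n | v.1 = r₂} \ {(r₂, e₂)}) ∈ ℬ :=
    fun c d r₁ r₂ e₁ e₂ h₁ h₂ h₃ h₄ h₅ => Or.inr ⟨c, d, r₁, r₂, e₁, e₂, h₁, h₂, h₃, h₄, h₅, rfl⟩
  have hconn : ∀ B ∈ ℬ, ((toroidalGrid (n + 1) n).induce B).Connected := by
    rintro _ (⟨c, d, r, h, rfl⟩ | ⟨c, d, r₁, r₂, e₁, e₂, h₁, h₂, h₃, h₄, h₅, rfl⟩)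
    · exact induce_union_connected
        (toroidalGrid_column_diff_connected (by omega) c d).preconnected
        (toroidalGrid_row_connected (by omega) r).preconnected ⟨(r, c), by simp [h.symm]⟩
    · refine induce_union_connected (induce_union_connected
        (toroidalGrid_column_diff_connected (by omega) c d).preconnected
        (toroidalGrid_row_diff_connected (by omega) r₁ e₁).preconnected
        ⟨(r₁, c), by simp [h₂.symm, h₄.symm]⟩).preconnected
        (toroidalGrid_row_diff_connected (by omega) r₂ e₂).preconnected
        ⟨(r₂, c), by simp [h₃.symm, h₅.symm]⟩
  have hcol : ∀ B ∈ ℬ, ∃ (c : Fin n) (d : Fin (n + 1)),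
      ({v : Fin (n + 1) × Fin n | v.2 = c} \ {(d, c)}) ⊆ B := by
    rintro _ (⟨c, d, r, h, rfl⟩ | ⟨c, d, r₁, r₂, e₁, e₂, h₁, h₂, h₃, h₄, h₅, rfl⟩)
    · exact ⟨c, d, Set.subset_union_left⟩
    · exact ⟨c, d, Set.subset_union_left.trans Set.subset_union_left⟩
  have hreach : ∀ B ∈ ℬ, ∀ (c : Fin n) (d : Fin (n + 1)), ∃ a ∈ B,
      ∃ b ∈ ({v : Fin (n + 1) × Fin n | v.2 = c} \ {(d, c)}),
        a = b ∨ (toroidalGrid (n + 1) n).Adj a b := by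
    rintro _ (⟨c, d, r, h, rfl⟩ | ⟨c, d, r₁, r₂, e₁, e₂, h₁, h₂, h₃, h₄, h₅, rfl⟩) c' d'
    · obtain ⟨a, ha, hb⟩ := toroidalGrid_row_column_eq_or_adj (by omega) r d' c'
      exact ⟨a, Or.inr ha, hb⟩
    · by_cases hr : r₁ = d'
      · obtain ⟨a, ha, hb⟩ := toroidalGrid_row_diff_column_eq_or_adj (by omega)
          (hr ▸ h₁.symm : r₂ ≠ d') e₂ c'
        exact ⟨a, Or.inr ha, hb⟩
      · obtain ⟨a, ha, hb⟩ := toroidalGrid_row_diff_column_eq_or_adj (by omega) hr e₁ c'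
        exact ⟨a, Or.inl (Or.inr ha), hb⟩
  have hbramble : IsBramble (toroidalGrid (n + 1) n) ℬ := by
    refine ⟨hconn, fun A hA B hB => ?_⟩
    obtain ⟨c, d, hsub⟩ := hcol B hB
    obtain ⟨a, ha, b, hb, hab⟩ := hreach A hA c d
    exact induce_union_connected_of_eq_or_adj (hconn A hA) (hconn B hB) ha (hsub hb) hab
  have hupper : IsHittingSet ℬ (({0, 1} : Set (Fin (n + 1))) ×ˢ Set.univ) := by
    intro B hB
    obtain ⟨c, d, hsub⟩ := hcol B hB
    have h01 : (0 : Fin (n + 1)) ≠ 1 := by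
      rw [Ne, Fin.zero_eq_one_iff]
      omega
    by_cases hd : d = 0
    · exact ⟨(1, c), by simp, hsub (by simp [hd, h01.symm])⟩
    · exact ⟨(0, c), by simp, hsub (by simp [Ne.symm hd])⟩
  have hcard : (({0, 1} : Set (Fin (n + 1))) ×ˢ (Set.univ : Set (Fin n))).ncard = 2 * n := by
    rw [Set.ncard_prod, Set.ncard_univ, Nat.card_fin, Set.ncard_pair]
    rw [Ne, Fin.zero_eq_one_iff]
    omega
  have hlower : ∀ T, IsHittingSet ℬ T → 2 * n ≤ T.ncard := by
    intro T hT
    classical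
    obtain ⟨S, rfl⟩ := T.toFinite.exists_finset_coe
    rw [Set.ncard_coe_finset]
    by_contra! hlt
    obtain ⟨c, -, hc⟩ := Finset.exists_card_fiber_lt_of_card_lt_mul (s := S)
      (t := (Finset.univ : Finset (Fin n))) (f := Prod.snd) (n := 2)
      (by simpa [mul_comm] using hlt)
    have hc' : ∀ x y, (x, c) ∈ S → (y, c) ∈ S → x = y := by
      intro x y hx hy
      have := Finset.card_le_one.1 (Nat.le_of_lt_succ hc) (x, c) (by simp [hx]) (y, c)
        (by simp [hy])
      exact congrArg Prod.fst this
    by_cases hrow : ∀ r, ∃ e, (r, e) ∈ S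
    · obtain ⟨x, hx, y, hy, z, hz, hxy, hxz, hyz⟩ :=
        Finset.two_lt_card.1 (two_lt_card_rows_of_card_lt hlt hrow)
      have key : ∃ d r₁ r₂ : Fin (n + 1), r₁ ≠ r₂ ∧ d ≠ r₁ ∧ d ≠ r₂ ∧
          (S.filter fun v => v.1 = r₁).card = 1 ∧ (S.filter fun v => v.1 = r₂).card = 1 ∧
          ∀ w, (w, c) ∈ S → w = d := by
        simp only [Finset.mem_filter, Finset.mem_univ, true_and] at hx hy hz
        by_cases hd : ∃ d, (d, c) ∈ S
        · obtain ⟨d, hd⟩ := hd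
          by_cases hdx : d = x
          · exact ⟨d, y, z, hyz, hdx ▸ hxy, hdx ▸ hxz, hy, hz, fun w hw => hc' w d hw hd⟩
          · by_cases hdy : d = y
            · exact ⟨d, x, z, hxz, hdx, hdy ▸ hyz, hx, hz, fun w hw => hc' w d hw hd⟩
            · exact ⟨d, x, y, hxy, hdx, hdy, hx, hy, fun w hw => hc' w d hw hd⟩
        · exact ⟨z, x, y, hxy, hxz.symm, hyz.symm, hx, hy, fun w hw => absurd ⟨w, hw⟩ hd⟩
      obtain ⟨d, r₁, r₂, h₁, h₂, h₃, hr₁, hr₂, hd⟩ := key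
      obtain ⟨e₁, he₁⟩ := exists_unique_col_of_card_row_eq_one hr₁
      obtain ⟨e₂, he₂⟩ := exists_unique_col_of_card_row_eq_one hr₂
      have h₄ : e₁ ≠ c := fun h => h₂ (hd r₁ ((he₁ c).2 h.symm)).symm
      have h₅ : e₂ ≠ c := fun h => h₃ (hd r₂ ((he₂ c).2 h.symm)).symm
      obtain ⟨⟨x, y⟩, hS, hB⟩ := hT _ (hG c d r₁ r₂ e₁ e₂ h₁ h₂ h₃ h₄ h₅)
      simp at hS hB
      grind
    · push Not at hrow
      obtain ⟨r, hr⟩ := hrow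
      have key : ∃ d, d ≠ r ∧ ∀ w, (w, c) ∈ S → w = d := by
        by_cases hd : ∃ d, (d, c) ∈ S
        · obtain ⟨d, hd⟩ := hd
          exact ⟨d, fun h => hr c (h ▸ hd), fun w hw => hc' w d hw hd⟩
        · have : Nontrivial (Fin (n + 1)) := Fin.nontrivial_iff_two_le.2 (by omega)
          obtain ⟨d, hdr⟩ := exists_ne r
          exact ⟨d, hdr, fun w hw => absurd ⟨w, hw⟩ hd⟩
      obtain ⟨d, hdr, hd⟩ := key
      obtain ⟨⟨x, y⟩, hS, hB⟩ := hT _ (hF c d r hdr)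
      simp at hS hB
      grind
  have horder : brambleOrder ℬ = 2 * n := brambleOrder_eq hupper hcard hlower
  exact ⟨hbramble, horder, horder ▸ brambleOrder_le_brambleNumber hbramble⟩
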